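/- (Degree-bounded infeasibility certificate) Let A be an infeasible linear pencil of size α in n variables. Then −1 ∈ M_A^{(2^{min{α−1, n}} − 1)}, i.e., there exist polynomials p_i of degree at most 2^{min{α−1,n}} − 1 and vectors of polynomials v_j ∈ ℝ[x]^α with all entries of degree at most 2^{min{α−1,n}} − 1 such that −1 = Σ_i p_i² + Σ_j v_j^* A v_j. -/

import Mathlib

open MvPolynomial Matrix
attribute [local instance] Matrix.frobeniusNormedAddCommGroup

noncomputable section

abbrev RP (n : ℕ) := MvPolynomial (Fin n) ℝ

/-- Evaluation of the linear pencil `A₀ + ∑ xᵢ Aᵢ` at a point `x ∈ ℝⁿ`. -/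
def pencilEval {n α : ℕ} (A0 : Matrix (Fin α) (Fin α) ℝ) (A : Fin n → Matrix (Fin α) (Fin α) ℝ)
    (x : Fin n → ℝ) : Matrix (Fin α) (Fin α) ℝ :=
  A0 + ∑ i, x i • A i

/-- The linear pencil `A₀ + ∑ xᵢ Aᵢ` as a matrix of polynomials. -/
def pencilPoly {n α : ℕ} (A0 : Matrix (Fin α) (Fin α) ℝ) (A : Fin n → Matrix (Fin α) (Fin α) ℝ) :
    Matrix (Fin α) (Fin α) (RP n) :=
  A0.map C + ∑ i, (X i : RP n) • (A i).map C

/-- `v^* M v` for a matrix of polynomials. -/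
def quadForm {n α : ℕ} (M : Matrix (Fin α) (Fin α) (RP n)) (v : Fin α → RP n) : RP n :=
  v ⬝ᵥ (M *ᵥ v)

/-- A sum of squares of polynomials. -/
def IsSos {n : ℕ} (p : RP n) : Prop := ∃ (k : ℕ) (q : Fin k → RP n), p = ∑ i, q i ^ 2

/-- An sos-matrix: a finite sum `∑ vⱼ vⱼ^*` with `vⱼ` vectors of polynomials. -/
def IsSosMatrix {n α : ℕ} (S : Matrix (Fin α) (Fin α) (RP n)) : Prop :=
  ∃ (k : ℕ) (v : Fin k → Fin α → RP n), S = ∑ j, Matrix.vecMulVec (v j) (v j)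

/-- Membership in the quadratic module `M_A` associated to the pencil. -/
def InQuadModule {n α : ℕ} (A0 : Matrix (Fin α) (Fin α) ℝ)
    (A : Fin n → Matrix (Fin α) (Fin α) ℝ) (p : RP n) : Prop :=
  ∃ s, IsSos s ∧ ∃ (k : ℕ) (v : Fin k → Fin α → RP n),
    p = s + ∑ j, quadForm (pencilPoly A0 A) (v j)

/-- Strong infeasibility: positive distance (Frobenius norm) between the range of the
pencil and the PSD cone. -/
def StronglyInfeasible {n α : ℕ} (A0 : Matrix (Fin α) (Fin α) ℝ)
    (A : Fin n → Matrix (Fin α) (Fin α) ℝ) : Prop :=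
  ∃ ε > (0:ℝ), ∀ (x : Fin n → ℝ) (B : Matrix (Fin α) (Fin α) ℝ), B.PosSemidef →
    ε ≤ dist (pencilEval A0 A x) B
/-- Membership in the truncated quadratic module `M_A^{(k)}`. -/
def InTruncQuadModule {n α : ℕ} (A0 : Matrix (Fin α) (Fin α) ℝ)
    (A : Fin n → Matrix (Fin α) (Fin α) ℝ) (k : ℕ) (p : RP n) : Prop :=
  ∃ (r : ℕ) (q : Fin r → RP n) (s : ℕ) (v : Fin s → Fin α → RP n),
    (∀ i, (q i).totalDegree ≤ k) ∧ (∀ j a, (v j a).totalDegree ≤ k) ∧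
    p = (∑ i, q i ^ 2) + ∑ j, quadForm (pencilPoly A0 A) (v j)

/-- The convex hull of a compact set in a finite-dimensional space is compact. -/
theorem aux_isCompact_convexHull {E : Type} [NormedAddCommGroup E] [NormedSpace ℝ E]
    [FiniteDimensional ℝ E] {s : Set E} (hs : IsCompact s) : IsCompact (convexHull ℝ s) := by
  rcases s.eq_empty_or_nonempty with rfl | ⟨s0, hs0⟩
  · simp
  set N := Module.finrank ℝ E + 1 with hN
  have hc : IsCompact ((fun p : (Fin N → ℝ) × (Fin N → E) => ∑ i, p.1 i • p.2 i) ''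
      (stdSimplex ℝ (Fin N) ×ˢ Set.pi Set.univ (fun _ => s))) := by
    apply IsCompact.image
    · exact (isCompact_stdSimplex ℝ (Fin N)).prod (isCompact_univ_pi (fun _ => hs))
    · fun_prop
  convert hc using 1
  ext x
  constructor
  · intro hx
    obtain ⟨ι, _, z, w, hz, hai, hw, hw1, rfl⟩ := eq_pos_convex_span_of_mem_convexHull hx
    have hcard : Fintype.card ι ≤ Fintype.card (Fin N) := by
      have := hai.card_le_finrank_succ
      have h2 := Submodule.finrank_le (vectorSpan ℝ (Set.range z))
      simp only [Fintype.card_fin]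
      omega
    obtain ⟨e⟩ := Function.Embedding.nonempty_of_card_le hcard
    have hsum1 : ∑ j, Function.extend e w 0 j = ∑ i, w i := by
      symm
      apply Fintype.sum_of_injective e e.injective
      · intro j hj
        rw [Function.extend_apply' _ _ _ (by simpa using hj)]
        rfl
      · intro i
        rw [e.injective.extend_apply]
    have hsum2 : ∑ j, Function.extend e w 0 j • Function.extend e z (fun _ => s0) j
        = ∑ i, w i • z i := by
      symm
      apply Fintype.sum_of_injective e e.injective
      · intro j hj
        rw [Function.extend_apply' _ _ _ (by simpa using hj)]
        simp
      · intro i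
        rw [e.injective.extend_apply, e.injective.extend_apply]
    refine ⟨(Function.extend e w 0, Function.extend e z (fun _ => s0)), ⟨⟨?_, ?_⟩, ?_⟩, hsum2⟩
    · intro j
      by_cases hj : ∃ i, e i = j
      · obtain ⟨i, rfl⟩ := hj
        simp only [e.injective.extend_apply]
        exact (hw i).le
      · simp [Function.extend_apply' _ _ _ hj]
    · simp only [hsum1, hw1]
    · intro j _
      by_cases hj : ∃ i, e i = j
      · obtain ⟨i, rfl⟩ := hj
        simp only [e.injective.extend_apply]
        exact hz ⟨i, rfl⟩
      · simpa [Function.extend_apply' _ _ _ hj] using hs0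
  · rintro ⟨⟨w, z⟩, ⟨⟨hw, hw1⟩, hz⟩, rfl⟩
    apply (convex_convexHull ℝ s).sum_mem (fun i _ => hw i) hw1
    intro i _
    exact subset_convexHull ℝ s (hz i trivial)

/-- Affine functions on `ℝⁿ`: constant coefficient and linear coefficients. -/
abbrev Aff (n : ℕ) := ℝ × (Fin n → ℝ)

/-- The affine polynomial with given coefficients. -/
def affPoly {n : ℕ} : Aff n →ₗ[ℝ] RP n where
  toFun l := C l.1 + ∑ i, C (l.2 i) * X i
  map_add' a b := by
    simp only [Prod.fst_add, Prod.snd_add, Pi.add_apply, C_add, add_mul, Finset.sum_add_distrib]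
    ring
  map_smul' c a := by
    simp [MvPolynomial.smul_eq_C_mul, Finset.mul_sum, mul_assoc]

/-- Evaluation of an affine function. -/
def affEval {n : ℕ} (x : Fin n → ℝ) (l : Aff n) : ℝ := l.1 + ∑ i, l.2 i * x i

theorem affPoly_deg {n : ℕ} (l : Aff n) : (affPoly l).totalDegree ≤ 1 := by
  show (C l.1 + ∑ i, C (l.2 i) * X i : RP n).totalDegree ≤ 1
  refine (totalDegree_add _ _).trans (max_le (by simp) ?_)
  apply totalDegree_finsetSum_le
  intro i _
  refine (totalDegree_mul _ _).trans ?_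
  simp

theorem affPoly_one {n : ℕ} : affPoly ((1, 0) : Aff n) = 1 := by
  simp [affPoly]

section
variable {n α : ℕ} (A0 : Matrix (Fin α) (Fin α) ℝ) (A : Fin n → Matrix (Fin α) (Fin α) ℝ)

/-- The bilinear form `u^* A v` with values in affine functions. -/
def affB (u : Fin α → ℝ) : (Fin α → ℝ) →ₗ[ℝ] Aff n where
  toFun v := (u ⬝ᵥ (A0 *ᵥ v), fun i => u ⬝ᵥ (A i *ᵥ v))
  map_add' v w := by
    ext <;> simp [mulVec_add]
  map_smul' c v := by
    ext <;> simp [mulVec_smul]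

theorem affB_add (u v w : Fin α → ℝ) :
    affB A0 A (u + v) w = affB A0 A u w + affB A0 A v w := by
  ext <;> simp [affB]

theorem affB_smul (c : ℝ) (u v : Fin α → ℝ) :
    affB A0 A (c • u) v = c • affB A0 A u v := by
  ext <;> simp [affB]

theorem aux_symm {M : Matrix (Fin α) (Fin α) ℝ} (hM : M.IsSymm) (u v : Fin α → ℝ) :
    u ⬝ᵥ (M *ᵥ v) = v ⬝ᵥ (M *ᵥ u) := by
  rw [dotProduct_mulVec, dotProduct_comm, ← mulVec_transpose, hM.eq]

theorem affB_symm (hA0 : A0.IsSymm) (hA : ∀ i, (A i).IsSymm) (u v : Fin α → ℝ) :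
    affB A0 A u v = affB A0 A v u := by
  ext
  · exact aux_symm hA0 u v
  · exact aux_symm (hA _) u v

theorem affEval_affB (x : Fin n → ℝ) (u v : Fin α → ℝ) :
    affEval x (affB A0 A u v) = u ⬝ᵥ (pencilEval A0 A x *ᵥ v) := by
  simp [affEval, affB, pencilEval, add_mulVec, sum_mulVec, smul_mulVec, dotProduct_sum, mul_comm]

/-- Generators of the truncated cone relative to `U` and `V`. -/
def coneGen (U : Submodule ℝ (Aff n)) (V : Submodule ℝ (Fin α → ℝ)) (d : ℕ) : Set (RP n) :=
  {f | (∃ p : RP n, p.totalDegree ≤ d ∧ f = p ^ 2) ∨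
    (∃ u ∈ V, ∃ v ∈ V, ∃ q p : RP n, q.totalDegree ≤ d ∧ p.totalDegree ≤ d ∧
      f = q ^ 2 * affPoly (affB A0 A u u) + 2 * q * p * affPoly (affB A0 A u v)
        + p ^ 2 * affPoly (affB A0 A v v)) ∨
    (∃ l ∈ U, ∃ a b : RP n, a.totalDegree ≤ d ∧ b.totalDegree ≤ d ∧ f = affPoly l * (a * b))}

/-- The truncated cone relative to `U` and `V`. -/
def cone (U : Submodule ℝ (Aff n)) (V : Submodule ℝ (Fin α → ℝ)) (d : ℕ) :
    AddSubmonoid (RP n) := AddSubmonoid.closure (coneGen A0 A U V d)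

variable {A0 A}

theorem sq_mem_cone {U : Submodule ℝ (Aff n)} {V : Submodule ℝ (Fin α → ℝ)} {d : ℕ} {p : RP n}
    (hp : p.totalDegree ≤ d) : p ^ 2 ∈ cone A0 A U V d :=
  AddSubmonoid.subset_closure (Or.inl ⟨p, hp, rfl⟩)

theorem form_mem_cone {U : Submodule ℝ (Aff n)} {V : Submodule ℝ (Fin α → ℝ)} {d : ℕ}
    {u v : Fin α → ℝ} (hu : u ∈ V) (hv : v ∈ V) {p q : RP n}
    (hq : q.totalDegree ≤ d) (hp : p.totalDegree ≤ d) :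
    q ^ 2 * affPoly (affB A0 A u u) + 2 * q * p * affPoly (affB A0 A u v)
        + p ^ 2 * affPoly (affB A0 A v v) ∈ cone A0 A U V d :=
  AddSubmonoid.subset_closure (Or.inr (Or.inl ⟨u, hu, v, hv, q, p, hq, hp, rfl⟩))

theorem lin_mem_cone {U : Submodule ℝ (Aff n)} {V : Submodule ℝ (Fin α → ℝ)} {d : ℕ}
    {l : Aff n} (hl : l ∈ U) {a b : RP n} (ha : a.totalDegree ≤ d) (hb : b.totalDegree ≤ d) :
    affPoly l * (a * b) ∈ cone A0 A U V d :=
  AddSubmonoid.subset_closure (Or.inr (Or.inr ⟨l, hl, a, b, ha, hb, rfl⟩))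

theorem lin_mem_cone' {U : Submodule ℝ (Aff n)} {V : Submodule ℝ (Fin α → ℝ)} {d : ℕ}
    {l : Aff n} (hl : l ∈ U) : affPoly l ∈ cone A0 A U V d := by
  have := lin_mem_cone (A0 := A0) (A := A) (V := V) (d := d) hl (a := 1) (b := 1)
    (by simp) (by simp)
  simpa using this

theorem diag_mem_cone {U : Submodule ℝ (Aff n)} {V : Submodule ℝ (Fin α → ℝ)} {d : ℕ}
    {u : Fin α → ℝ} (hu : u ∈ V) : affPoly (affB A0 A u u) ∈ cone A0 A U V d := by
  have := form_mem_cone (A0 := A0) (A := A) (U := U) (d := d) hu hu (q := 1) (p := 0)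
    (by simp) (by simp)
  simpa using this

theorem cone_mono {U U' : Submodule ℝ (Aff n)} {V V' : Submodule ℝ (Fin α → ℝ)} {d d' : ℕ}
    (hU : U ≤ U') (hV : V ≤ V') (hd : d ≤ d') : cone A0 A U V d ≤ cone A0 A U' V' d' := by
  apply AddSubmonoid.closure_mono
  rintro f (⟨p, hp, rfl⟩ | ⟨u, hu, v, hv, q, p, hq, hp, rfl⟩ | ⟨l, hl, a, b, ha, hb, rfl⟩)
  · exact Or.inl ⟨p, hp.trans hd, rfl⟩
  · exact Or.inr (Or.inl ⟨u, hV hu, v, hV hv, q, p, hq.trans hd, hp.trans hd, rfl⟩)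
  · exact Or.inr (Or.inr ⟨l, hU hl, a, b, ha.trans hd, hb.trans hd, rfl⟩)

theorem deg_mul {p q : RP n} {a b : ℕ} (hp : p.totalDegree ≤ a) (hq : q.totalDegree ≤ b) :
    (p * q).totalDegree ≤ a + b :=
  (totalDegree_mul p q).trans (add_le_add hp hq)

theorem mul_sq_mem {U : Submodule ℝ (Aff n)} {V : Submodule ℝ (Fin α → ℝ)} {d e : ℕ}
    {f g : RP n} (hf : f ∈ cone A0 A U V d) (hg : g.totalDegree ≤ e) :
    g ^ 2 * f ∈ cone A0 A U V (e + d) := by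
  induction hf using AddSubmonoid.closure_induction with
  | mem f hf =>
    rcases hf with (⟨p, hp, rfl⟩ | ⟨u, hu, v, hv, q, p, hq, hp, rfl⟩ | ⟨l, hl, a, b, ha, hb, rfl⟩)
    · rw [← mul_pow]
      exact sq_mem_cone (deg_mul hg hp)
    · convert form_mem_cone (A0 := A0) (A := A) (U := U) hu hv (deg_mul hg hq) (deg_mul hg hp)
        using 1
      ring
    · convert lin_mem_cone (A0 := A0) (A := A) (V := V) hl (deg_mul hg ha) (deg_mul hg hb)
        using 1
      ring
  | zero => simp
  | add x y _ _ hx hy =>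
    rw [mul_add]
    exact add_mem hx hy

theorem smul_mem_cone {U : Submodule ℝ (Aff n)} {V : Submodule ℝ (Fin α → ℝ)} {d : ℕ}
    {f : RP n} (hf : f ∈ cone A0 A U V d) {c : ℝ} (hc : 0 ≤ c) :
    c • f ∈ cone A0 A U V d := by
  have h := mul_sq_mem (e := 0) (g := C (Real.sqrt c)) hf (by simp)
  rw [← C_pow, Real.sq_sqrt hc, zero_add] at h
  rwa [MvPolynomial.smul_eq_C_mul]

theorem const_mem_cone {U : Submodule ℝ (Aff n)} {V : Submodule ℝ (Fin α → ℝ)} {d : ℕ}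
    {c : ℝ} (hc : 0 ≤ c) : (C c : RP n) ∈ cone A0 A U V d := by
  have h := sq_mem_cone (A0 := A0) (A := A) (U := U) (V := V) (d := d) (p := C (Real.sqrt c))
    (by simp)
  rwa [← C_pow, Real.sq_sqrt hc] at h

variable (A0 A) in
/-- Infeasibility relative to `U` and `V`. -/
def RelInf (U : Submodule ℝ (Aff n)) (V : Submodule ℝ (Fin α → ℝ)) : Prop :=
  ∀ x : Fin n → ℝ, (∀ l ∈ U, affEval x l = 0) → ∃ v ∈ V, affEval x (affB A0 A v v) < 0

variable (A0 A) in
/-- The set to be separated from `U`. -/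
def sepK (V : Submodule ℝ (Fin α → ℝ)) : Set (Aff n) :=
  insert (1, 0) ((fun u => affB A0 A u u) '' ((V : Set (Fin α → ℝ)) ∩ Metric.sphere 0 1))

theorem isCompact_sepK (V : Submodule ℝ (Fin α → ℝ)) : IsCompact (sepK A0 A V) := by
  apply IsCompact.insert
  apply IsCompact.image
  · exact (isCompact_sphere 0 1).inter_left V.closed_of_finiteDimensional
  · have : Continuous fun u : Fin α → ℝ =>
        ((u ⬝ᵥ (A0 *ᵥ u), fun i => u ⬝ᵥ (A i *ᵥ u)) : Aff n) := by
      simp only [dotProduct, mulVec]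
      fun_prop
    exact this

theorem affEval_smul (x : Fin n → ℝ) (c : ℝ) (l : Aff n) :
    affEval x (c • l) = c * affEval x l := by
  simp [affEval, mul_add, Finset.mul_sum, mul_assoc]

theorem affEval_add (x : Fin n → ℝ) (l m : Aff n) :
    affEval x (l + m) = affEval x l + affEval x m := by
  simp only [affEval, Prod.fst_add, Prod.snd_add, Pi.add_apply, add_mul, Finset.sum_add_distrib]
  ring

theorem clm_eq (f : Aff n →L[ℝ] ℝ) (hf : f (1, 0) ≠ 0) (l : Aff n) :
    f l = f (1, 0) * affEval (fun i => f (0, Pi.single i 1) / f (1, 0)) l := by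
  have h : l = l.1 • ((1, 0) : Aff n) + ∑ i, l.2 i • ((0, Pi.single i 1) : Aff n) := by
    ext j
    · simp [Prod.fst_sum]
    · simp [Prod.snd_sum, Finset.sum_apply, Pi.single_apply]
  conv_lhs => rw [h]
  simp only [map_add, map_smul, map_sum, smul_eq_mul, affEval, mul_add, Finset.mul_sum]
  congr 1
  · ring
  · apply Finset.sum_congr rfl
    intro i _
    field_simp

theorem sep_lemma {U : Submodule ℝ (Aff n)} {V : Submodule ℝ (Fin α → ℝ)}
    (h : RelInf A0 A U V) : ∃ z ∈ sepK A0 A V, -affPoly z ∈ cone A0 A U V 0 := by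
  have hK : ∀ z ∈ sepK A0 A V, affPoly z ∈ cone A0 A U V 0 := by
    rintro z (rfl | ⟨u, ⟨hu, -⟩, rfl⟩)
    · rw [affPoly_one]
      simpa using sq_mem_cone (A0 := A0) (A := A) (U := U) (V := V) (d := 0) (p := 1) (by simp)
    · exact diag_mem_cone hu
  by_cases hd : Disjoint (convexHull ℝ (sepK A0 A V)) (U : Set (Aff n))
  · exfalso
    obtain ⟨f, s, t, hs, hst, ht⟩ := geometric_hahn_banach_compact_closed
      (convex_convexHull ℝ _) (aux_isCompact_convexHull (isCompact_sepK V)) U.convex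
      U.closed_of_finiteDimensional hd
    have ht0 : t < 0 := by simpa using ht 0 U.zero_mem
    have hneg : ∀ z ∈ sepK A0 A V, f z < 0 := fun z hz =>
      ((hs z (subset_convexHull ℝ _ hz)).trans hst).trans ht0
    have h1 : f (1, 0) < 0 := hneg _ (Set.mem_insert _ _)
    have hU : ∀ l ∈ U, f l = 0 := by
      intro l hl
      by_contra hne
      have := ht ((t / f l) • l) (U.smul_mem _ hl)
      rw [map_smul, smul_eq_mul, div_mul_cancel₀ _ hne] at this
      exact lt_irrefl _ this
    obtain ⟨v, hv, hvneg⟩ := h (fun i => f (0, Pi.single i 1) / f (1, 0)) (by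
      intro l hl
      have := clm_eq f h1.ne l
      rw [hU l hl] at this
      rcases mul_eq_zero.1 this.symm with h | h
      · exact absurd h h1.ne
      · exact h)
    have hv0 : v ≠ 0 := by
      rintro rfl
      simp [affEval] at hvneg
    have hnv : 0 < ‖v‖ := norm_pos_iff.2 hv0
    have h2 := hneg (affB A0 A (‖v‖⁻¹ • v) (‖v‖⁻¹ • v)) (Or.inr ⟨‖v‖⁻¹ • v, ⟨V.smul_mem _ hv, by
      simp [norm_smul, hnv.ne']⟩, rfl⟩)
    rw [clm_eq f h1.ne, affB_smul, map_smul, affEval_smul, affEval_smul] at h2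
    have hi : 0 < ‖v‖⁻¹ := inv_pos.2 hnv
    have h3 := mul_pos_of_neg_of_neg h1 (mul_neg_of_pos_of_neg hi (mul_neg_of_pos_of_neg hi hvneg))
    linarith
  · obtain ⟨c, hc, hcU⟩ := Set.not_disjoint_iff.1 hd
    obtain ⟨ι, _, w, z, hw, hw1, hz, hsum⟩ := mem_convexHull_iff_exists_fintype.1 hc
    obtain ⟨i, hi⟩ : ∃ i, 0 < w i := by
      by_contra! hcon
      have : ∑ i, w i ≤ 0 := Finset.sum_nonpos (fun i _ => hcon i)
      linarith
    refine ⟨z i, hz i, ?_⟩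
    classical
    have h1 : -affPoly (z i) =
        (w i)⁻¹ • (∑ j ∈ Finset.univ.erase i, w j • affPoly (z j) + affPoly (-c)) := by
      have h2 : w i • affPoly (z i) + ∑ j ∈ Finset.univ.erase i, w j • affPoly (z j)
          = affPoly c := by
        rw [Finset.add_sum_erase _ (fun j => w j • affPoly (z j)) (Finset.mem_univ i), ← hsum]
        simp
      rw [map_neg, ← h2]
      rw [show ∀ a b : RP n, b + -(a + b) = -a by intros; ring, smul_neg, smul_smul,
        inv_mul_cancel₀ hi.ne', one_smul]
    rw [h1]
    apply smul_mem_cone _ (inv_nonneg.2 hi.le)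
    apply add_mem
    · exact sum_mem (fun j _ => smul_mem_cone (hK _ (hz j)) (hw j))
    · exact lin_mem_cone' (U.neg_mem hcU)

/-- If `±z` lie in the degree zero cone then adjoining `z` to `U` does not change cones. -/
theorem cone_adjoin {U : Submodule ℝ (Aff n)} {V : Submodule ℝ (Fin α → ℝ)} {z : Aff n}
    (h1 : affPoly z ∈ cone A0 A U V 0) (h2 : -affPoly z ∈ cone A0 A U V 0) (d : ℕ) :
    cone A0 A (U ⊔ Submodule.span ℝ {z}) V d ≤ cone A0 A U V d := by
  apply (AddSubmonoid.closure_le).2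
  rintro f (⟨p, hp, rfl⟩ | ⟨u, hu, v, hv, q, p, hq, hp, rfl⟩ | ⟨l, hl, a, b, ha, hb, rfl⟩)
  · exact sq_mem_cone hp
  · exact form_mem_cone hu hv hq hp
  · obtain ⟨l0, hl0, y, hy, rfl⟩ := Submodule.mem_sup.1 hl
    obtain ⟨t, rfl⟩ := Submodule.mem_span_singleton.1 hy
    rw [map_add, add_mul, map_smul]
    refine add_mem (lin_mem_cone hl0 ha hb) ?_
    have e : (t • affPoly z) * (a * b) = (C (1/2) * (C t * a + b)) ^ 2 * affPoly z
        + (C (1/2) * (C t * a - b)) ^ 2 * (-affPoly z) := by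
      rw [MvPolynomial.smul_eq_C_mul]
      have h4 : (C (1/2) ^ 2 * 4 : RP n) = 1 := by
        rw [show (4 : RP n) = C 4 from (map_ofNat C 4).symm, ← C_pow, ← C_mul]
        norm_num
      linear_combination (-(C t * affPoly z * a * b)) * h4
    rw [e]
    have hta : (C t * a).totalDegree ≤ d := by
      simpa using deg_mul (p := C t) (q := a) (a := 0) (by simp) ha
    apply add_mem
    · have := mul_sq_mem h1 (g := C (1/2) * (C t * a + b)) (e := d) (by
        simpa using deg_mul (p := C (1/2)) (q := C t * a + b) (a := 0) (b := d) (by simp)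
          ((totalDegree_add _ _).trans (max_le hta hb)))
      simpa using this
    · have := mul_sq_mem h2 (g := C (1/2) * (C t * a - b)) (e := d) (by
        simpa using deg_mul (p := C (1/2)) (q := C t * a - b) (a := 0) (b := d) (by simp)
          ((totalDegree_sub _ _).trans (max_le hta hb)))
      simpa using this

theorem neg_sq_mem {U : Submodule ℝ (Aff n)} {V : Submodule ℝ (Fin α → ℝ)} {u v : Fin α → ℝ}
    (hu : u ∈ V) (hv : v ∈ V) (hU : affB A0 A u u ∈ U) :
    -(affPoly (affB A0 A u v)) ^ 2 ∈ cone A0 A U V 1 := by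
  set q : RP n := C (-1/2) * (affPoly (affB A0 A v v) + 1) with hq
  have hqd : q.totalDegree ≤ 1 := by
    simpa using deg_mul (p := C (-1/2)) (q := affPoly (affB A0 A v v) + 1) (a := 0) (b := 1)
      (by simp) ((totalDegree_add _ _).trans (max_le (affPoly_deg _) (by simp)))
  have h1 := form_mem_cone (A0 := A0) (A := A) (U := U) hu hv hqd (affPoly_deg (affB A0 A u v))
  have h2 := lin_mem_cone (A0 := A0) (A := A) (V := V) (U.neg_mem hU) hqd hqd
  convert add_mem h1 h2 using 1
  have h3 : (2 * C (-1/2) : RP n) = -1 := by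
    rw [show (2 : RP n) = C 2 from (map_ofNat C 2).symm, ← C_mul]
    norm_num
  rw [map_neg, hq]
  linear_combination
    (-(affPoly (affB A0 A u v)) ^ 2 * (affPoly (affB A0 A v v) + 1)) * h3

theorem cone_lift {U : Submodule ℝ (Aff n)} {V V' : Submodule ℝ (Fin α → ℝ)} {u : Fin α → ℝ}
    (hu : u ∈ V) (hV : V' ≤ V) (hU : affB A0 A u u ∈ U) {d : ℕ} {f : RP n}
    (hf : f ∈ cone A0 A (U ⊔ V.map (affB A0 A u)) V' d) :
    ∀ ε : ℝ, 0 < ε → f + C ε ∈ cone A0 A U V (2 * d + 1) := by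
  induction hf using AddSubmonoid.closure_induction with
  | mem f hf =>
    intro ε hε
    rcases hf with (⟨p, hp, rfl⟩ | ⟨u', hu', v, hv, q, p, hq, hp, rfl⟩ | ⟨l, hl, a, b, ha, hb, rfl⟩)
    · exact add_mem (sq_mem_cone (hp.trans (by omega))) (const_mem_cone hε.le)
    · exact add_mem (form_mem_cone (hV hu') (hV hv) (hq.trans (by omega)) (hp.trans (by omega)))
        (const_mem_cone hε.le)
    · obtain ⟨l0, hl0, y, hy, rfl⟩ := Submodule.mem_sup.1 hl
      obtain ⟨v, hv, rfl⟩ := Submodule.mem_map.1 hy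
      rw [map_add, add_mul, add_assoc]
      refine add_mem (lin_mem_cone hl0 (ha.trans (by omega)) (hb.trans (by omega))) ?_
      set L := affPoly (affB A0 A u v) with hL
      have hab : (C (1 / (2 * ε)) * (a * b)).totalDegree ≤ 2 * d := by
        have := deg_mul (p := C (1 / (2 * ε))) (q := a * b) (a := 0) (totalDegree_C _).le (deg_mul ha hb)
        omega
      have h1 : (1 + C (1 / (2 * ε)) * (a * b) * L) ^ 2 ∈ cone A0 A U V (2 * d + 1) := by
        apply sq_mem_cone
        exact (totalDegree_add _ _).trans (max_le (by simp) (deg_mul hab (affPoly_deg _)))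
      have h2 := mul_sq_mem (neg_sq_mem hu hv hU) hab
      have h3 := smul_mem_cone (add_mem h1 h2) hε.le
      convert h3 using 1
      have h4 : (C ε * C (1 / (2 * ε)) * 2 : RP n) = 1 := by
        rw [show (2 : RP n) = C 2 from (map_ofNat C 2).symm, ← C_mul, ← C_mul]
        rw [show ε * (1 / (2 * ε)) * 2 = 1 by field_simp]
        simp
      rw [MvPolynomial.smul_eq_C_mul]
      linear_combination (-(a * b * L)) * h4
  | zero =>
    intro ε hε
    rw [zero_add]
    exact const_mem_cone hε.le
  | add x y _ _ hx hy =>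
    intro ε hε
    have := add_mem (hx (ε / 2) (half_pos hε)) (hy (ε / 2) (half_pos hε))
    convert this using 1
    rw [show (C ε : RP n) = C (ε / 2) + C (ε / 2) by rw [← C_add, add_halves]]
    ring

theorem neg_one_of_neg_const {U : Submodule ℝ (Aff n)} {V : Submodule ℝ (Fin α → ℝ)} {d : ℕ}
    {c : ℝ} (hc : c < 0) (h : (C c : RP n) ∈ cone A0 A U V d) : (-1 : RP n) ∈ cone A0 A U V d := by
  have := smul_mem_cone h (c := -c⁻¹) (neg_nonneg.2 (inv_nonpos.2 hc.le))
  rw [MvPolynomial.smul_eq_C_mul, ← C_mul, neg_mul, inv_mul_cancel₀ hc.ne] at this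
  simpa using this

theorem main_ind (hA0 : A0.IsSymm) (hA : ∀ i, (A i).IsSymm) (N : ℕ) :
    ∀ (U : Submodule ℝ (Aff n)) (V : Submodule ℝ (Fin α → ℝ)),
    Module.finrank ℝ V + (n + 1 - Module.finrank ℝ U) = N → RelInf A0 A U V →
    (-1 : RP n) ∈ cone A0 A U V
      (2 ^ (min (Module.finrank ℝ V - 1) (n - Module.finrank ℝ U)) - 1) := by
  induction N using Nat.strong_induction_on with
  | _ N ih =>
  intro U V hN hinf
  have hfr : Module.finrank ℝ (Aff n) = n + 1 := by simp [add_comm]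
  have hUle := Submodule.finrank_le U
  by_cases h1U : ((1, 0) : Aff n) ∈ U
  · have := lin_mem_cone' (A0 := A0) (A := A) (V := V)
      (d := 2 ^ (min (Module.finrank ℝ V - 1) (n - Module.finrank ℝ U)) - 1) (U.neg_mem h1U)
    rwa [map_neg, affPoly_one] at this
  obtain ⟨z, hz, hzneg⟩ := sep_lemma hinf
  rcases hz with rfl | ⟨u, ⟨huV, hu1⟩, rfl⟩
  · rw [affPoly_one] at hzneg
    exact cone_mono le_rfl le_rfl (Nat.zero_le _) hzneg
  simp only at hzneg
  have hu0 : u ≠ 0 := by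
    rintro rfl
    simp at hu1
  by_cases hzU : affB A0 A u u ∈ U
  swap
  · -- adjoin `z` to `U`
    have hlt : U < U ⊔ Submodule.span ℝ {affB A0 A u u} := by
      refine lt_of_le_of_ne le_sup_left ?_
      intro heq
      apply hzU
      rw [heq]
      exact Submodule.mem_sup_right (Submodule.mem_span_singleton_self _)
    have hfl := Submodule.finrank_lt_finrank_of_lt hlt
    have hle' := Submodule.finrank_le (U ⊔ Submodule.span ℝ {affB A0 A u u})
    have hi := ih _ (by omega) (U ⊔ Submodule.span ℝ {affB A0 A u u}) V rfl (by
      intro x hx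
      exact hinf x (fun l hl => hx l (Submodule.mem_sup_left hl)))
    have hi2 := cone_adjoin (diag_mem_cone huV) hzneg _ hi
    refine cone_mono le_rfl le_rfl ?_ hi2
    apply Nat.sub_le_sub_right
    apply Nat.pow_le_pow_right (by norm_num)
    omega
  · -- the isotropic case
    obtain ⟨W, hW⟩ := Submodule.exists_isCompl (Submodule.span ℝ {u})
    have hspan : Submodule.span ℝ {u} ≤ V := by
      rw [Submodule.span_le]; simpa using huV
    set V' := W ⊓ V with hV'
    have hsup : Submodule.span ℝ {u} ⊔ V' = V := by
      rw [hV', ← sup_inf_assoc_of_le W hspan, hW.sup_eq_top, top_inf_eq]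
    have hdisj : Disjoint (Submodule.span ℝ {u}) V' := hW.disjoint.mono_right inf_le_left
    have hdimV : Module.finrank ℝ V = 1 + Module.finrank ℝ V' := by
      have h := Submodule.finrank_sup_add_finrank_inf_eq (Submodule.span ℝ {u}) V'
      rw [hsup, hdisj.eq_bot, finrank_bot, finrank_span_singleton hu0] at h
      simpa using h
    have hV'V : V' ≤ V := inf_le_right
    have hdec : ∀ v ∈ V, ∃ t : ℝ, ∃ v' ∈ V', v = t • u + v' := by
      intro v hv
      rw [← hsup] at hv
      obtain ⟨y, hy, v', hv', rfl⟩ := Submodule.mem_sup.1 hv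
      obtain ⟨t, rfl⟩ := Submodule.mem_span_singleton.1 hy
      exact ⟨t, v', hv', rfl⟩
    set U' := U ⊔ V.map (affB A0 A u) with hU'
    have hUU' : U ≤ U' := le_sup_left
    have hmono := Submodule.finrank_mono hUU'
    have hinf' : RelInf A0 A U' V' := by
      intro x hx
      obtain ⟨v, hv, hneg⟩ := hinf x (fun l hl => hx l (hUU' hl))
      obtain ⟨t, v', hv', rfl⟩ := hdec v hv
      refine ⟨v', hv', ?_⟩
      have e1 : affEval x (affB A0 A u u) = 0 := hx _ (hUU' hzU)
      have e2 : affEval x (affB A0 A u v') = 0 :=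
        hx _ (Submodule.mem_sup_right (Submodule.mem_map_of_mem (hV'V hv')))
      have e3 : affEval x (affB A0 A v' u) = 0 := by rw [affB_symm A0 A hA0 hA]; exact e2
      simpa [affB_add, affB_smul, affEval_add, affEval_smul, e1, e2, e3] using hneg
    have hi := ih _ (by omega) U' V' rfl hinf'
    by_cases hall : ∀ v ∈ V, affB A0 A u v ∈ U
    · have hUeq : U' = U := by
        rw [hU', sup_eq_left]
        rintro _ ⟨v, hv, rfl⟩
        exact hall v hv
      rw [hUeq] at hi
      refine cone_mono le_rfl hV'V ?_ hi
      apply Nat.sub_le_sub_right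
      apply Nat.pow_le_pow_right (by norm_num)
      omega
    push Not at hall
    obtain ⟨v, hv, hvU⟩ := hall
    by_cases hn : n ≤ Module.finrank ℝ U
    · -- zero-dimensional case
      have htop : U ⊔ Submodule.span ℝ {((1, 0) : Aff n)} = ⊤ := by
        have hlt : U < U ⊔ Submodule.span ℝ {((1, 0) : Aff n)} := by
          refine lt_of_le_of_ne le_sup_left ?_
          intro heq
          apply h1U
          rw [heq]
          exact Submodule.mem_sup_right (Submodule.mem_span_singleton_self _)
        have hfl := Submodule.finrank_lt_finrank_of_lt hlt
        have hle' := Submodule.finrank_le (U ⊔ Submodule.span ℝ {((1, 0) : Aff n)})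
        apply Submodule.eq_top_of_finrank_eq
        omega
      have hdecU : ∀ l : Aff n, ∃ l0 ∈ U, ∃ c : ℝ, l = l0 + c • ((1, 0) : Aff n) := by
        intro l
        have : l ∈ U ⊔ Submodule.span ℝ {((1, 0) : Aff n)} := by rw [htop]; trivial
        obtain ⟨l0, hl0, y, hy, rfl⟩ := Submodule.mem_sup.1 this
        obtain ⟨t, rfl⟩ := Submodule.mem_span_singleton.1 hy
        exact ⟨l0, hl0, t, rfl⟩
      obtain ⟨l0, hl0, c, hc⟩ := hdecU (affB A0 A u v)
      obtain ⟨l1, hl1, e, he⟩ := hdecU (affB A0 A v v)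
      have hc0 : c ≠ 0 := by
        rintro rfl
        apply hvU
        rw [hc]
        simpa using hl0
      set t : ℝ := -(1 + e) / (2 * c) with ht
      have hmem : t • u + v ∈ V := V.add_mem (V.smul_mem _ huV) hv
      have hd := diag_mem_cone (A0 := A0) (A := A) (U := U) (d := 0) hmem
      have heq : affB A0 A (t • u + v) (t • u + v) + -((t * t) • affB A0 A u u + (2 * t) • l0 + l1)
          = -((1, 0) : Aff n) := by
        rw [affB_add, affB_smul, map_add, map_add, map_smul, map_smul,
          affB_symm A0 A hA0 hA v u, hc, he]
        have : 2 * t * c + e = -1 := by rw [ht]; field_simp; ring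
        have h2 : (-((1, 0) : Aff n)) = (2 * t * c + e) • ((1, 0) : Aff n) := by
          rw [this]; simp
        rw [h2]
        module
      have hl := lin_mem_cone' (A0 := A0) (A := A) (V := V) (d := 0) (U.neg_mem
        (U.add_mem (U.add_mem (U.smul_mem (t * t) hzU) (U.smul_mem (2 * t) hl0)) hl1))
      have hs := add_mem hd hl
      rw [← map_add, heq, map_neg, affPoly_one] at hs
      exact cone_mono le_rfl le_rfl (Nat.zero_le _) hs
    · have hlt : U < U' := by
        refine lt_of_le_of_ne hUU' ?_
        intro heq
        apply hvU
        rw [heq]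
        exact Submodule.mem_sup_right (Submodule.mem_map_of_mem hv)
      have hfl := Submodule.finrank_lt_finrank_of_lt hlt
      have hV'pos : 1 ≤ Module.finrank ℝ V' := by
        by_contra hcon
        have hb : V' = ⊥ := Submodule.finrank_eq_zero.1 (by omega)
        obtain ⟨t, v', hv', rfl⟩ := hdec v hv
        rw [hb, Submodule.mem_bot] at hv'
        apply hvU
        rw [hv', add_zero, map_smul]
        exact U.smul_mem _ hzU
      have h5 := cone_lift huV hV'V hzU hi (1/2) (by norm_num)
      rw [show (-1 + C (1/2) : RP n) = C (-1/2) by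
        rw [show (-1 : RP n) = C (-1) by simp, ← C_add]; norm_num] at h5
      have h6 := neg_one_of_neg_const (by norm_num) h5
      refine cone_mono le_rfl le_rfl ?_ h6
      set m := min (Module.finrank ℝ V' - 1) (n - Module.finrank ℝ U') with hm
      have hle : m + 1 ≤ min (Module.finrank ℝ V - 1) (n - Module.finrank ℝ U) := by omega
      have hp := Nat.pow_le_pow_right (n := 2) (by norm_num) hle
      have hp1 : 1 ≤ 2 ^ m := Nat.one_le_two_pow
      rw [pow_succ] at hp
      omega

variable (A0 A) in
theorem affPoly_affB (u v : Fin α → ℝ) : affPoly (affB A0 A u v) =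
    (fun a => C (u a)) ⬝ᵥ (pencilPoly A0 A *ᵥ (fun a => C (v a))) := by
  simp only [affPoly, affB, pencilPoly, add_mulVec, sum_mulVec, dotProduct_add, dotProduct_sum,
    smul_mulVec, dotProduct_smul, smul_eq_mul, LinearMap.coe_mk, AddHom.coe_mk]
  have h : ∀ M : Matrix (Fin α) (Fin α) ℝ, (C (u ⬝ᵥ (M *ᵥ v)) : RP n) =
      (fun a => C (u a)) ⬝ᵥ (M.map C *ᵥ (fun a => C (v a))) := by
    intro M
    simp [dotProduct, mulVec, map_sum]
  rw [h]
  congr 1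
  apply Finset.sum_congr rfl
  intro i _
  rw [h, mul_comm]

theorem trunc_of_cone (hA0 : A0.IsSymm) (hA : ∀ i, (A i).IsSymm) {d : ℕ} {f : RP n}
    (hf : f ∈ cone A0 A ⊥ ⊤ d) : InTruncQuadModule A0 A d f := by
  induction hf using AddSubmonoid.closure_induction with
  | mem f hf =>
    rcases hf with (⟨p, hp, rfl⟩ | ⟨u, hu, v, hv, q, p, hq, hp, rfl⟩ | ⟨l, hl, a, b, ha, hb, rfl⟩)
    · exact ⟨1, fun _ => p, 0, Fin.elim0, fun _ => hp, fun j => j.elim0, by simp⟩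
    · refine ⟨0, Fin.elim0, 1, fun _ a => q * C (u a) + p * C (v a), fun j => j.elim0, ?_, ?_⟩
      · intro _ a
        refine (totalDegree_add _ _).trans (max_le ?_ ?_)
        · simpa using deg_mul (q := C (u a)) (b := 0) hq (by simp)
        · simpa using deg_mul (q := C (v a)) (b := 0) hp (by simp)
      · have hvec : (fun a => q * C (u a) + p * C (v a) : Fin α → RP n) =
            q • (fun a => C (u a)) + p • (fun a => C (v a)) := by
          ext1 a; simp
        simp only [quadForm, hvec, Finset.univ_eq_empty, Finset.sum_empty, zero_add,
          Finset.sum_const, Finset.card_univ, Fintype.card_fin, one_smul, mulVec_add,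
          mulVec_smul, dotProduct_add, add_dotProduct, smul_dotProduct, dotProduct_smul,
          ← affPoly_affB, smul_eq_mul]
        rw [affB_symm A0 A hA0 hA v u]
        ring
    · rw [Submodule.mem_bot] at hl
      subst hl
      exact ⟨0, Fin.elim0, 0, Fin.elim0, fun j => j.elim0, fun j => j.elim0, by simp⟩
  | zero => exact ⟨0, Fin.elim0, 0, Fin.elim0, fun j => j.elim0, fun j => j.elim0, by simp⟩
  | add x y _ _ hx hy =>
    obtain ⟨r, q, s, v, hq, hv, rfl⟩ := hx
    obtain ⟨r', q', s', v', hq', hv', rfl⟩ := hy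
    refine ⟨r + r', Fin.append q q', s + s', Fin.append v v', ?_, ?_, ?_⟩
    · intro i
      refine Fin.addCases (fun i => ?_) (fun i => ?_) i
      · simpa using hq i
      · simpa using hq' i
    · intro i a
      refine Fin.addCases (fun i => ?_) (fun i => ?_) i
      · simpa using hv i a
      · simpa using hv' i a
    · simp only [Fin.sum_univ_add, Fin.append_left, Fin.append_right]
      ring

theorem relInf_start (hA0 : A0.IsSymm) (hA : ∀ i, (A i).IsSymm)
    (hinf : ∀ x : Fin n → ℝ, ¬ (pencilEval A0 A x).PosSemidef) : RelInf A0 A ⊥ ⊤ := by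
  intro x _
  by_contra! hcon
  apply hinf x
  apply Matrix.PosSemidef.of_dotProduct_mulVec_nonneg
  · have hs : (pencilEval A0 A x).IsSymm := by
      simp only [Matrix.IsSymm, pencilEval, transpose_add, transpose_sum, transpose_smul,
        hA0.eq, (hA _).eq]
    rw [Matrix.IsHermitian, conjTranspose_eq_transpose_of_trivial]
    exact hs
  · intro v
    have := hcon v trivial
    rwa [affEval_affB] at this

end

/-- Degree-bounded infeasibility certificate: for an infeasible pencil of size `α` in
`n` variables, `-1 ∈ M_A^{(2^{min{α−1,n}} − 1)}`. -/
theorem stmt_16 {n α : ℕ} (A0 : Matrix (Fin α) (Fin α) ℝ)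
    (A : Fin n → Matrix (Fin α) (Fin α) ℝ) (hA0 : A0.IsSymm) (hA : ∀ i, (A i).IsSymm)
    (hinf : ∀ x : Fin n → ℝ, ¬ (pencilEval A0 A x).PosSemidef) :
    InTruncQuadModule A0 A (2 ^ (min (α - 1) n) - 1) (-1) := by
  have h := main_ind hA0 hA _ ⊥ ⊤ rfl (relInf_start hA0 hA hinf)
  rw [finrank_bot, finrank_top, Module.finrank_fin_fun, Nat.sub_zero] at h
  exact trunc_of_cone hA0 hA h
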